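/- Let h be a symmetric positive semidefinite m×m real matrix with smallest eigenvalue λ and trace H. If the squared Frobenius norm satisfies ‖h‖² ≤ H·λ, then h = λ·I = (H/m)·I; that is, h is a scalar multiple of the identity and all its eigenvalues are equal. -/

import Mathlib

/-- The quadratic form `vᵀ h v` of an `m × m` matrix `h` (given as `Fin m → Fin m → ℝ`). -/
def quadForm {m : ℕ} (h : Fin m → Fin m → ℝ) (v : Fin m → ℝ) : ℝ :=
  ∑ i, ∑ j, v i * h i j * v j

/-- **Algebraic core of Süss' theorem.**  Let `h` be a symmetric positive semidefinite
`m × m` real matrix with smallest eigenvalue `lam` and trace `H`.  If the squared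
Frobenius norm satisfies `‖h‖² ≤ H · lam`, then `h = lam · I = (H/m) · I`; that is, `h` is
a scalar multiple of the identity and all its eigenvalues are equal. -/
theorem umbilic_of_frobenius_le
    (m : ℕ) (hm : 0 < m) (h : Fin m → Fin m → ℝ)
    (hsym : ∀ i j, h i j = h j i) (hpsd : ∀ v, 0 ≤ quadForm h v)
    (lam : ℝ)
    (hmin : ∀ v : Fin m → ℝ, lam * ∑ i, (v i) ^ 2 ≤ quadForm h v)
    (heig : ∃ v : Fin m → ℝ, v ≠ 0 ∧ ∀ i, ∑ j, h i j * v j = lam * v i)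
    (hfrob : ∑ i, ∑ j, (h i j) ^ 2 ≤ (∑ i, h i i) * lam) :
    (∀ i j, h i j = if i = j then lam else 0) ∧ lam = (∑ i, h i i) / m := by
  have hd : ∀ i, lam ≤ h i i := by
    intro i
    have h1 := hmin (Pi.single i 1)
    simpa [quadForm, Pi.single_apply] using h1
  have hl : 0 ≤ lam := by
    obtain ⟨v, hv, he⟩ := heig
    have hq : quadForm h v = lam * ∑ i, (v i) ^ 2 := by
      unfold quadForm
      rw [Finset.mul_sum]
      refine Finset.sum_congr rfl fun i _ => ?_
      have h2 : ∑ j, v i * h i j * v j = v i * ∑ j, h i j * v j := by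
        rw [Finset.mul_sum]
        exact Finset.sum_congr rfl fun j _ => by ring
      rw [h2, he]
      ring
    have hpos : 0 < ∑ i, (v i) ^ 2 := by
      obtain ⟨i, hi⟩ := Function.ne_iff.mp hv
      have hi' : v i ≠ 0 := hi
      exact Finset.sum_pos' (fun j _ => sq_nonneg _) ⟨i, Finset.mem_univ i, by positivity⟩
    have h3 := hpsd v
    rw [hq] at h3
    exact nonneg_of_mul_nonneg_left h3 hpos
  have hsplit : ∀ i, ∑ j, (h i j) ^ 2 =
      (h i i) ^ 2 + ∑ j ∈ Finset.univ.erase i, (h i j) ^ 2 := fun i =>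
    (Finset.add_sum_erase _ _ (Finset.mem_univ i)).symm
  have hoff : ∀ i, 0 ≤ ∑ j ∈ Finset.univ.erase i, (h i j) ^ 2 := fun i =>
    Finset.sum_nonneg fun j _ => sq_nonneg _
  have hdiag : ∀ i, 0 ≤ h i i * (h i i - lam) := fun i =>
    mul_nonneg (hl.trans (hd i)) (sub_nonneg.mpr (hd i))
  have hnn : ∀ i ∈ Finset.univ, 0 ≤ ∑ j, (h i j) ^ 2 - h i i * lam := by
    intro i _
    rw [hsplit]
    nlinarith [hoff i, hdiag i]
  have hz : ∑ i, (∑ j, (h i j) ^ 2 - h i i * lam) = 0 := by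
    apply le_antisymm _ (Finset.sum_nonneg hnn)
    rw [Finset.sum_sub_distrib, ← Finset.sum_mul]
    linarith
  have hz' := (Finset.sum_eq_zero_iff_of_nonneg hnn).mp hz
  have hii : ∀ i, h i i = lam := by
    intro i
    have h1 := hz' i (Finset.mem_univ i)
    rw [hsplit] at h1
    have h2 : h i i * (h i i - lam) = 0 := by nlinarith [hoff i, hdiag i]
    rcases mul_eq_zero.mp h2 with h3 | h3
    · linarith [hd i]
    · linarith
  refine ⟨fun i j => ?_, ?_⟩
  · split_ifs with hij
    · rw [← hij, hii]
    · have h1 := hz' i (Finset.mem_univ i)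
      rw [hsplit] at h1
      have h2 : ∑ j ∈ Finset.univ.erase i, (h i j) ^ 2 = 0 := by nlinarith [hoff i, hdiag i]
      have h3 := (Finset.sum_eq_zero_iff_of_nonneg fun j _ => sq_nonneg (h i j)).mp h2 j
        (Finset.mem_erase.mpr ⟨Ne.symm hij, Finset.mem_univ j⟩)
      exact pow_eq_zero_iff (two_ne_zero) |>.mp h3
  · have hm' : (m : ℝ) ≠ 0 := by positivity
    simp only [hii, Finset.sum_const, Finset.card_univ, Fintype.card_fin, nsmul_eq_mul]
    field_simp
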